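/- Let D ≥ 3 and let S_M, S_N be positive natural numbers with 2·S_M ≤ D·S_N, S_N ≤ S_M, and 2·S_M ≥ D (so that K = ⌊2·S_M/D⌋ ≥ 1). Suppose every storage device stores data of the same size B > 0 (so B̂ = D·B). Suppose on each device, independently across devices, the defender's CPU count M_i is uniform on {1, …, K} and the attacker's CPU count N_i equals 0 with probability 1 - S_N/S_M and otherwise is uniform on {1, …, K}. Then the expected data protection level E[(1/B̂)·∑_{i=1}^{D} B·sgn(M_i - N_i)] = 1 - S_N/S_M, and the expected utility of the defender E[∑_{i=1}^{D} B·sgn(M_i - N_i)] = (1 - S_N/S_M)·B̂. -/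

import Mathlib

/-- The signs of all pairwise differences of the elements of a finite set sum to zero. -/
theorem Finset.sum_sum_sign_sub_eq_zero (s : Finset ℕ) :
    ∑ m ∈ s, ∑ n ∈ s, ((Int.sign ((m : ℤ) - (n : ℤ)) : ℤ) : ℝ) = 0 := by
  have h : ∑ m ∈ s, ∑ n ∈ s, ((Int.sign ((m : ℤ) - (n : ℤ)) : ℤ) : ℝ) =
      -∑ m ∈ s, ∑ n ∈ s, ((Int.sign ((m : ℤ) - (n : ℤ)) : ℤ) : ℝ) := by
    conv_lhs => rw [Finset.sum_comm]
    simp only [← Finset.sum_neg_distrib]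
    refine Finset.sum_congr rfl fun m _ => Finset.sum_congr rfl fun n _ => ?_
    rw [← Int.cast_neg, ← Int.sign_neg, neg_sub]
  linarith

/-- If one player draws uniformly from `{1, …, K}` and the other plays `0` with weight `1 - p` and
draws uniformly from `{1, …, K}` with weight `p`, the expected sign of the difference is `1 - p`. -/
theorem sum_Icc_expected_sign {K : ℕ} (hK : 0 < K) (p : ℝ) :
    ∑ m ∈ Finset.Icc 1 K, (1 / (K : ℝ)) *
      ((1 - p) * ((Int.sign (m : ℤ) : ℤ) : ℝ) +
        p * (1 / (K : ℝ)) *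
          ∑ n ∈ Finset.Icc 1 K, ((Int.sign ((m : ℤ) - (n : ℤ)) : ℤ) : ℝ)) = 1 - p := by
  have hK' : (K : ℝ) ≠ 0 := by positivity
  have hs : ∑ m ∈ Finset.Icc 1 K, ((Int.sign (m : ℤ) : ℤ) : ℝ) = K := by
    rw [Finset.sum_congr rfl (g := fun _ => (1 : ℝ))]
    · simp
    · intro m hm
      rw [Int.sign_eq_one_of_pos (by have := (Finset.mem_Icc.1 hm).1; omega), Int.cast_one]
  rw [← Finset.mul_sum, Finset.sum_add_distrib, ← Finset.mul_sum, ← Finset.mul_sum, hs,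
    Finset.sum_sum_sign_sub_eq_zero]
  field_simp
  ring


/-- Corollary 2: at the asymmetric Nash equilibrium of Theorem 2 (each device
stores data of the same size `B`, defender's CPU count on each device uniform
on `{1,…,K}` with `K = ⌊2·S_M/D⌋`, attacker's CPU count `0` with probability
`1 - S_N/S_M` and otherwise uniform on `{1,…,K}`), the expected data protection
level equals `1 - S_N/S_M` and the expected utility of the defender equals
`(1 - S_N/S_M)·B̂` with `B̂ = D·B`. -/
theorem corollary2_expected_protection_and_utility
    (D S_M S_N : ℕ) (hD : 3 ≤ D) (hSM : 0 < S_M) (hSN : 0 < S_N)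
    (h1 : 2 * S_M ≤ D * S_N) (h2 : S_N ≤ S_M) (h3 : D ≤ 2 * S_M)
    (K : ℕ) (hK : K = 2 * S_M / D)
    (B : ℝ) (hB : 0 < B) :
    (1 / ((D : ℝ) * B)) * (∑ _i : Fin D, B *
        ∑ m ∈ Finset.Icc 1 K, (1 / (K : ℝ)) *
          ((1 - (S_N : ℝ) / (S_M : ℝ)) * ((Int.sign (m : ℤ) : ℤ) : ℝ) +
            ((S_N : ℝ) / (S_M : ℝ)) * (1 / (K : ℝ)) *
              ∑ n ∈ Finset.Icc 1 K, ((Int.sign ((m : ℤ) - (n : ℤ)) : ℤ) : ℝ))) =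
      1 - (S_N : ℝ) / (S_M : ℝ) ∧
    (∑ _i : Fin D, B *
        ∑ m ∈ Finset.Icc 1 K, (1 / (K : ℝ)) *
          ((1 - (S_N : ℝ) / (S_M : ℝ)) * ((Int.sign (m : ℤ) : ℤ) : ℝ) +
            ((S_N : ℝ) / (S_M : ℝ)) * (1 / (K : ℝ)) *
              ∑ n ∈ Finset.Icc 1 K, ((Int.sign ((m : ℤ) - (n : ℤ)) : ℤ) : ℝ))) =
      (1 - (S_N : ℝ) / (S_M : ℝ)) * ((D : ℝ) * B) := by
  have hK0 : 0 < K := hK ▸ Nat.div_pos h3 (by omega)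
  have hD0 : (D : ℝ) ≠ 0 := by positivity
  rw [sum_Icc_expected_sign hK0, Finset.sum_const, Finset.card_univ, Fintype.card_fin, nsmul_eq_mul]
  constructor
  · field_simp
  · ring
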